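/- There is no pin word of length n ≥ 4 ending in the two letters 'd','r' whose generated centred permutation equals the centred permutation generated by another pin word in which the lowest point corresponds to the initial numeral; i.e., in any collision {w₁,w₂} of pin words of length ≥ 6 with w₁ ending in 'dr', the lowest point of the common permutation cannot be the first point placed by w₂. -/

import Mathlib

/-- A *centred permutation*: `vals` is the one-line notation of the filled-in
permutation (length `n+1`), `origin` the index of the origin point. -/
structure CPerm where
  vals : List ℕ
  origin : ℕ
deriving DecidableEq

namespace CPerm

/-- Length of a centred permutation (origin does not count). -/
def len (p : CPerm) : ℕ := p.vals.length - 1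

/-- A genuine centred permutation: one-line notation is a permutation of
`{0, …, N-1}` and the origin index is in range. -/
def IsValid (p : CPerm) : Prop :=
  p.vals ≠ [] ∧ p.origin < p.vals.length ∧ p.vals.Perm (List.range p.vals.length)

def valAt (p : CPerm) (i : ℕ) : ℕ := p.vals.getD i 0

def originVal (p : CPerm) : ℕ := p.valAt p.origin

/-- The box-sum `p ⊞ q`: inflate the origin of `q` by a copy of `p`. -/
def boxSum (p q : CPerm) : CPerm :=
  let N := p.vals.length
  let v := q.originVal
  let shift : ℕ → ℕ := fun u => if u < v then u else u + (N - 1)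
  ⟨(q.vals.take q.origin).map shift ++ p.vals.map (· + v) ++
      (q.vals.drop (q.origin + 1)).map shift,
    q.origin + p.origin⟩

/-- The trivial centred permutation (origin only, length 0). -/
def trivial : CPerm := ⟨[0], 0⟩

/-- Iterated box-sum `σ₁ ⊞ σ₂ ⊞ ⋯ ⊞ σₙ`. -/
def boxSumList (l : List CPerm) : CPerm := l.foldr boxSum trivial

/-- `p` is ⊞-indecomposable: nonempty and not a box-sum of two strictly smaller
centred permutations. -/
def BoxIndecomposable (p : CPerm) : Prop :=
  1 ≤ p.len ∧
    ¬∃ a b : CPerm, a.IsValid ∧ b.IsValid ∧ 1 ≤ a.len ∧ 1 ≤ b.len ∧ boxSum a b = p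

/-- The non-origin point at index `i` of `p` lies in quadrant `q` (1–4,
numbered anticlockwise). -/
def InQuadrant (p : CPerm) (q : ℕ) (i : ℕ) : Prop :=
  i < p.vals.length ∧ i ≠ p.origin ∧
    ((q = 1 ∧ p.origin < i ∧ p.originVal < p.valAt i) ∨
     (q = 2 ∧ i < p.origin ∧ p.originVal < p.valAt i) ∨
     (q = 3 ∧ i < p.origin ∧ p.valAt i < p.originVal) ∨
     (q = 4 ∧ p.origin < i ∧ p.valAt i < p.originVal))

/-- All non-origin points of `p` lie in quadrant `q`. -/
def OneQuadrant (p : CPerm) (q : ℕ) : Prop :=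
  ∀ i, i < p.vals.length → i ≠ p.origin → InQuadrant p q i

def OppositeQuadrants (q₁ q₂ : ℕ) : Prop :=
  (q₁ = 1 ∧ q₂ = 3) ∨ (q₁ = 3 ∧ q₂ = 1) ∨ (q₁ = 2 ∧ q₂ = 4) ∨ (q₁ = 4 ∧ q₂ = 2)

/-- Centred pattern containment `p ≤ q` (origins must match up). -/
def PatternLE (p q : CPerm) : Prop :=
  ∃ f : ℕ → ℕ,
    (∀ i j, i < p.vals.length → j < p.vals.length → i < j → f i < f j) ∧
    (∀ i, i < p.vals.length → f i < q.vals.length) ∧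
    f p.origin = q.origin ∧
    (∀ i j, i < p.vals.length → j < p.vals.length →
      (p.valAt i < p.valAt j ↔ q.valAt (f i) < q.valAt (f j)))

/-- A centred permutation class: nonempty, consisting of valid centred
permutations, and downward closed under centred containment. -/
def IsClass (S : Set CPerm) : Prop :=
  S.Nonempty ∧ (∀ p ∈ S, p.IsValid) ∧
    ∀ p q : CPerm, q ∈ S → p.IsValid → PatternLE p q → p ∈ S

/-- `S` is closed under the box-sum. -/
def BoxClosed (S : Set CPerm) : Prop := ∀ p ∈ S, ∀ q ∈ S, boxSum p q ∈ S

/-- Number of centred permutations of length `n` in `S`. -/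
noncomputable def count (S : Set CPerm) (n : ℕ) : ℕ := {p | p ∈ S ∧ p.len = n}.ncard

/-- The single-point centred permutation in quadrant `q`. -/
def mu : ℕ → CPerm
  | 1 => ⟨[0, 1], 0⟩
  | 2 => ⟨[1, 0], 1⟩
  | 3 => ⟨[0, 1], 1⟩
  | 4 => ⟨[1, 0], 0⟩
  | _ => ⟨[0], 0⟩

def AdjacentQuadrants (a b : ℕ) : Prop :=
  (a, b) = (1, 2) ∨ (a, b) = (2, 3) ∨ (a, b) = (3, 4) ∨ (a, b) = (4, 1) ∨
  (a, b) = (2, 1) ∨ (a, b) = (3, 2) ∨ (a, b) = (4, 3) ∨ (a, b) = (1, 4)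

/-- The adjacency condition on a centred class. -/
def AdjacencyCondition (S : Set CPerm) : Prop :=
  (∃! q : ℕ, q ∈ ({1, 2, 3, 4} : Set ℕ) ∧ mu q ∈ S) ∨
    ∃ a b : ℕ, AdjacentQuadrants a b ∧ mu a ∈ S ∧ mu b ∈ S

end CPerm

inductive PinLetter | u | d | l | r
deriving DecidableEq

def PinLetter.isVert : PinLetter → Bool
  | .u => true
  | .d => true
  | .l => false
  | .r => false

/-- Letters strictly alternate between vertical and horizontal alignment. -/
def PinAlt (ls : List PinLetter) : Prop :=
  List.Chain' (fun a b => a.isVert ≠ b.isVert) ls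

/-- A pin word: an initial numeral `q ∈ {1,…,4}` followed by alternating letters. -/
def IsPinWord (q : ℕ) (ls : List PinLetter) : Prop := 1 ≤ q ∧ q ≤ 4 ∧ PinAlt ls

def firstPt : ℕ → ℚ × ℚ
  | 1 => (1, 1)
  | 2 => (-1, 1)
  | 3 => (-1, -1)
  | 4 => (1, -1)
  | _ => (1, 1)

def maxOf (l : List ℚ) : ℚ := l.foldr max 0
def minOf (l : List ℚ) : ℚ := l.foldr min 0

/-- Place the next pin: beyond the bounding rectangle in the given direction,
separating the previous point from all the others. The list holds the points
newest-first; the origin `(0,0)` is the last entry. -/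
def pinStep (pts : List (ℚ × ℚ)) (dir : PinLetter) : List (ℚ × ℚ) :=
  let last := pts.headD (0, 0)
  let rest := pts.tail
  let btwY : ℚ :=
    if maxOf (rest.map Prod.snd) < last.2 then (last.2 + maxOf (rest.map Prod.snd)) / 2
    else (last.2 + minOf (rest.map Prod.snd)) / 2
  let btwX : ℚ :=
    if maxOf (rest.map Prod.fst) < last.1 then (last.1 + maxOf (rest.map Prod.fst)) / 2
    else (last.1 + minOf (rest.map Prod.fst)) / 2
  let np : ℚ × ℚ :=
    match dir with
    | .r => (maxOf (pts.map Prod.fst) + 1, btwY)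
    | .l => (minOf (pts.map Prod.fst) - 1, btwY)
    | .u => (btwX, maxOf (pts.map Prod.snd) + 1)
    | .d => (btwX, minOf (pts.map Prod.snd) - 1)
  np :: pts

/-- The points (newest first, origin last) drawn from a pin word. -/
def pinPts (q : ℕ) (ls : List PinLetter) : List (ℚ × ℚ) :=
  ls.foldl pinStep [firstPt q, (0, 0)]

/-- Convert a finite set of plane points (with origin `(0,0)`) into a centred
permutation in canonical form. -/
def toCPerm (pts : List (ℚ × ℚ)) : CPerm :=
  ⟨(pts.mergeSort (fun a b => decide (a.1 ≤ b.1))).map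
      (fun pt => ((pts.map Prod.snd).filter (fun y => decide (y < pt.2))).length),
    ((pts.map Prod.fst).filter (fun x => decide (x < 0))).length⟩

/-- The centred pin permutation of a pin word. -/
def pinPerm (q : ℕ) (ls : List PinLetter) : CPerm := toCPerm (pinPts q ls)

/-- The complete pin class `P°`: the downward closure of all box-sums of
centred pin permutations. -/
def CompletePinClass : Set CPerm :=
  {p | p.IsValid ∧
    ∃ ws : List (ℕ × List PinLetter), (∀ w ∈ ws, IsPinWord w.1 w.2) ∧
      CPerm.PatternLE p (CPerm.boxSumList (ws.map fun w => pinPerm w.1 w.2))}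

/-- An infinite pin sequence: numeral `q` and letters `f 0, f 1, …`,
alternating in alignment. -/
def IsPinSeq (q : ℕ) (f : ℕ → PinLetter) : Prop :=
  1 ≤ q ∧ q ≤ 4 ∧ ∀ n, (f n).isVert ≠ (f (n + 1)).isVert

def seqPrefix (f : ℕ → PinLetter) (n : ℕ) : List PinLetter := (List.range n).map f

/-- The pin class of an infinite pin sequence. -/
def PinClassOf (q : ℕ) (f : ℕ → PinLetter) : Set CPerm :=
  {p | p.IsValid ∧ ∃ n : ℕ, CPerm.PatternLE p (pinPerm q (seqPrefix f n))}

/-- The `i`-th point (`i ≥ 1`) placed when drawing the pin sequence. -/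
def seqPoint (q : ℕ) (f : ℕ → PinLetter) (i : ℕ) : ℚ × ℚ :=
  (pinPts q (seqPrefix f (i - 1))).headD (0, 0)

/-- The quadrant of a plane point. -/
def quadOf (pt : ℚ × ℚ) : ℕ :=
  if 0 < pt.1 then (if 0 < pt.2 then 1 else 4) else (if 0 < pt.2 then 2 else 3)

/-- The pin word `w` is the pin factor of the sequence starting at position `i ≥ 1`
(first letter replaced by the quadrant of the corresponding point). -/
def FactorAt (q : ℕ) (f : ℕ → PinLetter) (i : ℕ) (w : ℕ × List PinLetter) : Prop :=
  1 ≤ i ∧ w.1 = quadOf (seqPoint q f i) ∧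
    ∀ t, t < w.2.length → w.2.getD t PinLetter.u = f (i - 1 + t)

/-- A recurrent pin factor: one occurring arbitrarily late. -/
def RecurrentFactor (q : ℕ) (f : ℕ → PinLetter) (w : ℕ × List PinLetter) : Prop :=
  ∀ N : ℕ, ∃ i, N ≤ i ∧ FactorAt q f i w

/-- The ⊞-interior of a pin class: the ⊞-closure (as a class) of the
permutations generated by recurrent pin factors. -/
def BoxInterior (q : ℕ) (f : ℕ → PinLetter) : Set CPerm :=
  {p | p.IsValid ∧
    ∃ l : List CPerm,
      (∀ x ∈ l, ∃ w : ℕ × List PinLetter, RecurrentFactor q f w ∧ x = pinPerm w.1 w.2) ∧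
      CPerm.PatternLE p (CPerm.boxSumList l)}

/-- The first point placed when drawing a pin word (the point of the initial
numeral): the second-to-last entry of the newest-first point list. -/
def firstPlacedPoint (q : ℕ) (ls : List PinLetter) : ℚ × ℚ :=
  (pinPts q ls).reverse.getD 1 (0, 0)

/-- The point `pt` is the (strictly) lowest point of the drawing of a pin word. -/
def IsLowestPoint (q : ℕ) (ls : List PinLetter) (pt : ℚ × ℚ) : Prop :=
  pt ∈ pinPts q ls ∧ ∀ p ∈ pinPts q ls, p = pt ∨ pt.2 < p.2

namespace PinAux

theorem le_maxOf {l : List ℚ} {x : ℚ} (h : x ∈ l) : x ≤ maxOf l := by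
  induction l with
  | nil => simp at h
  | cons a t ih =>
    simp only [maxOf, List.foldr_cons] at *
    rcases List.mem_cons.1 h with h | h
    · subst h; exact le_max_left _ _
    · exact (ih h).trans (le_max_right _ _)

theorem maxOf_nonneg (l : List ℚ) : 0 ≤ maxOf l := by
  induction l with
  | nil => simp [maxOf]
  | cons a t ih => exact ih.trans (le_max_right _ _)

theorem minOf_le {l : List ℚ} {x : ℚ} (h : x ∈ l) : minOf l ≤ x := by
  induction l with
  | nil => simp at h
  | cons a t ih =>
    simp only [minOf, List.foldr_cons] at *
    rcases List.mem_cons.1 h with h | h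
    · subst h; exact min_le_left _ _
    · exact (min_le_right _ _).trans (ih h)

theorem minOf_nonpos (l : List ℚ) : minOf l ≤ 0 := by
  induction l with
  | nil => simp [minOf]
  | cons a t ih => exact (min_le_right _ _).trans ih

/-- The point added by `pinStep`. -/
def np (pts : List (ℚ × ℚ)) (s : PinLetter) : ℚ × ℚ := (pinStep pts s).headD (0, 0)

theorem pinStep_eq (pts : List (ℚ × ℚ)) (s : PinLetter) : pinStep pts s = np pts s :: pts := rfl

theorem pinPts_snoc (q : ℕ) (l : List PinLetter) (s : PinLetter) :
    pinPts q (l ++ [s]) = np (pinPts q l) s :: pinPts q l := by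
  simp [pinPts, List.foldl_append, pinStep_eq]

theorem pinPts_append_suffix (q : ℕ) (l m : List PinLetter) :
    ∃ k, pinPts q (l ++ m) = k ++ pinPts q l := by
  induction m using List.reverseRecOn with
  | nil => exact ⟨[], by simp⟩
  | append_singleton m s ih =>
    obtain ⟨k, hk⟩ := ih
    refine ⟨np (pinPts q (l ++ m)) s :: k, ?_⟩
    rw [← List.append_assoc, pinPts_snoc, hk]; rfl

theorem pinPts_sub (q : ℕ) (l m : List PinLetter) {p : ℚ × ℚ} (h : p ∈ pinPts q l) :
    p ∈ pinPts q (l ++ m) := by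
  obtain ⟨k, hk⟩ := pinPts_append_suffix q l m
  rw [hk]; exact List.mem_append_right _ h

theorem zero_mem (q : ℕ) (l : List PinLetter) : ((0, 0) : ℚ × ℚ) ∈ pinPts q l :=
  pinPts_sub q [] l (by simp [pinPts])

theorem first_mem (q : ℕ) (l : List PinLetter) : firstPt q ∈ pinPts q l :=
  pinPts_sub q [] l (by simp [pinPts])

theorem firstPlaced (q : ℕ) (l : List PinLetter) : firstPlacedPoint q l = firstPt q := by
  obtain ⟨k, hk⟩ := pinPts_append_suffix q [] l
  simp only [List.nil_append] at hk
  unfold firstPlacedPoint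
  rw [hk]
  simp [pinPts]

theorem np_r {pts : List (ℚ × ℚ)} {p : ℚ × ℚ} (h : p ∈ pts) : p.1 < (np pts .r).1 := by
  have := le_maxOf (List.mem_map_of_mem (f := Prod.fst) h)
  simp only [np, pinStep, List.headD_cons]; linarith

theorem np_l {pts : List (ℚ × ℚ)} {p : ℚ × ℚ} (h : p ∈ pts) : (np pts .l).1 < p.1 := by
  have := minOf_le (List.mem_map_of_mem (f := Prod.fst) h)
  simp only [np, pinStep, List.headD_cons]; linarith

theorem np_u {pts : List (ℚ × ℚ)} {p : ℚ × ℚ} (h : p ∈ pts) : p.2 < (np pts .u).2 := by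
  have := le_maxOf (List.mem_map_of_mem (f := Prod.snd) h)
  simp only [np, pinStep, List.headD_cons]; linarith

theorem np_d {pts : List (ℚ × ℚ)} {p : ℚ × ℚ} (h : p ∈ pts) : (np pts .d).2 < p.2 := by
  have := minOf_le (List.mem_map_of_mem (f := Prod.snd) h)
  simp only [np, pinStep, List.headD_cons]; linarith

def Ext (c : ℚ) (rest : List ℚ) : Prop := maxOf rest < c ∨ c < minOf rest

def Sep (x e : ℚ) (rest : List ℚ) : Prop :=
  (x < e ∧ ∀ p ∈ rest, p < x) ∨ (e < x ∧ ∀ p ∈ rest, x < p)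

theorem sep_of_ext {c : ℚ} {rest : List ℚ} (h : Ext c rest) :
    Sep (if maxOf rest < c then (c + maxOf rest) / 2 else (c + minOf rest) / 2) c rest := by
  split_ifs with h1
  · left
    refine ⟨by linarith, fun p hp => ?_⟩
    have := le_maxOf hp
    linarith
  · right
    have h2 := h.resolve_left h1
    refine ⟨by linarith, fun p hp => ?_⟩
    have := minOf_le hp
    linarith

theorem pinPts_ne_nil (q : ℕ) (l : List PinLetter) : ∃ c rest, pinPts q l = c :: rest := by
  have := zero_mem q l
  cases h : pinPts q l with
  | nil => simp [h] at this
  | cons c r => exact ⟨c, r, rfl⟩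

theorem extX {q : ℕ} (h1 : 1 ≤ q) (h4 : q ≤ 4) {l : List PinLetter} {c rest}
    (h : pinPts q l = c :: rest) (hl : ∀ s ∈ l.getLast?, s.isVert = false) :
    Ext c.1 (rest.map Prod.fst) := by
  induction l using List.reverseRecOn with
  | nil =>
    simp only [pinPts, List.foldl_nil, List.cons.injEq] at h
    obtain ⟨rfl, rfl⟩ := h
    interval_cases q <;> simp [Ext, firstPt, maxOf, minOf]
  | append_singleton m s ih =>
    rw [pinPts_snoc] at h
    simp only [List.cons.injEq] at h
    obtain ⟨rfl, rfl⟩ := h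
    have hs : s.isVert = false := hl s (by simp)
    cases s <;> simp [PinLetter.isVert] at hs <;> simp [Ext, np, pinStep]

theorem extY {q : ℕ} (h1 : 1 ≤ q) (h4 : q ≤ 4) {l : List PinLetter} {c rest}
    (h : pinPts q l = c :: rest) (hl : ∀ s ∈ l.getLast?, s.isVert = true) :
    Ext c.2 (rest.map Prod.snd) := by
  induction l using List.reverseRecOn with
  | nil =>
    simp only [pinPts, List.foldl_nil, List.cons.injEq] at h
    obtain ⟨rfl, rfl⟩ := h
    interval_cases q <;> simp [Ext, firstPt, maxOf, minOf]
  | append_singleton m s ih =>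
    rw [pinPts_snoc] at h
    simp only [List.cons.injEq] at h
    obtain ⟨rfl, rfl⟩ := h
    have hs : s.isVert = true := hl s (by simp)
    cases s <;> simp [PinLetter.isVert] at hs <;> simp [Ext, np, pinStep]

theorem alt_last {l : List PinLetter} {s : PinLetter} (h : PinAlt (l ++ [s])) :
    PinAlt l ∧ ∀ t ∈ l.getLast?, t.isVert ≠ s.isVert := by
  have h' : List.IsChain (fun a b : PinLetter => a.isVert ≠ b.isVert) (l ++ [s]) := h
  rw [List.isChain_append] at h'
  exact ⟨h'.1, fun t ht => h'.2.2 t ht s (by simp)⟩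

theorem sepX {q : ℕ} (h1 : 1 ≤ q) (h4 : q ≤ 4) {l : List PinLetter} {s : PinLetter} {c rest}
    (hp : PinAlt (l ++ [s])) (hs : s.isVert = true) (h : pinPts q l = c :: rest) :
    Sep (np (c :: rest) s).1 c.1 (rest.map Prod.fst) := by
  have he := extX h1 h4 h (fun t ht => by
    have := (alt_last hp).2 t ht
    simpa [hs] using this)
  have := sep_of_ext he
  cases s <;> simp [PinLetter.isVert] at hs <;> simpa [np, pinStep] using this

theorem sepY {q : ℕ} (h1 : 1 ≤ q) (h4 : q ≤ 4) {l : List PinLetter} {s : PinLetter} {c rest}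
    (hp : PinAlt (l ++ [s])) (hs : s.isVert = false) (h : pinPts q l = c :: rest) :
    Sep (np (c :: rest) s).2 c.2 (rest.map Prod.snd) := by
  have he := extY h1 h4 h (fun t ht => by
    have := (alt_last hp).2 t ht
    simpa [hs] using this)
  have := sep_of_ext he
  cases s <;> simp [PinLetter.isVert] at hs <;> simpa [np, pinStep] using this

theorem distinctX {q : ℕ} (h1 : 1 ≤ q) (h4 : q ≤ 4) {l : List PinLetter} (hp : PinAlt l) :
    (pinPts q l).Pairwise (fun a b => a.1 ≠ b.1) := by
  induction l using List.reverseRecOn with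
  | nil =>
    simp only [pinPts, List.foldl_nil]
    interval_cases q <;> simp [firstPt]
  | append_singleton m s ih =>
    rw [pinPts_snoc, List.pairwise_cons]
    refine ⟨fun b hb => ?_, ih (alt_last hp).1⟩
    by_cases hs : s.isVert = true
    · obtain ⟨c, rest, h⟩ := pinPts_ne_nil q m
      have := sepX h1 h4 hp hs h
      rw [h] at hb ⊢
      rcases List.mem_cons.1 hb with rfl | hb
      · rcases this with h | h
        · exact h.1.ne
        · exact h.1.ne'
      · have hb' := List.mem_map_of_mem (f := Prod.fst) hb
        rcases this with h | h
        · exact (h.2 _ hb').ne'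
        · exact (h.2 _ hb').ne
    · cases s <;> simp [PinLetter.isVert] at hs
      · exact (np_l hb).ne
      · exact (np_r hb).ne'

/-- ranks -/
def xr (P : List (ℚ × ℚ)) (a : ℚ × ℚ) : ℕ := P.countP (fun p => decide (p.1 < a.1))
def yr (P : List (ℚ × ℚ)) (a : ℚ × ℚ) : ℕ := P.countP (fun p => decide (p.2 < a.2))

theorem rank_lt (g : ℚ × ℚ → ℚ) {P : List (ℚ × ℚ)} {a b : ℚ × ℚ} (ha : a ∈ P)
    (h : g a < g b) :
    P.countP (fun p => decide (g p < g a)) < P.countP (fun p => decide (g p < g b)) := by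
  induction P with
  | nil => simp at ha
  | cons c t ih =>
    have hmono : t.countP (fun p => decide (g p < g a)) ≤ t.countP (fun p => decide (g p < g b)) :=
      List.countP_mono_left (fun x _ hx => by
        simp only [decide_eq_true_eq] at *; exact hx.trans h)
    simp only [List.countP_cons, decide_eq_true_eq]
    rcases List.mem_cons.1 ha with rfl | ha
    · simp [h]; omega
    · have := ih ha
      split_ifs with h1 h2 <;> first | omega | (exact absurd (h1.trans h) h2)

theorem rank_lt_iff (g : ℚ × ℚ → ℚ) {P : List (ℚ × ℚ)} {a b : ℚ × ℚ} (ha : a ∈ P) (hb : b ∈ P) :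
    P.countP (fun p => decide (g p < g a)) < P.countP (fun p => decide (g p < g b)) ↔
    g a < g b := by
  refine ⟨fun h => ?_, rank_lt g ha⟩
  by_contra hn
  rcases (not_lt.1 hn).lt_or_eq with h' | h'
  · have := rank_lt g hb h'; omega
  · rw [h'] at h; omega

theorem xr_lt_iff {P : List (ℚ × ℚ)} {a b : ℚ × ℚ} (ha : a ∈ P) (hb : b ∈ P) :
    xr P a < xr P b ↔ a.1 < b.1 := rank_lt_iff Prod.fst ha hb

theorem yr_lt_iff {P : List (ℚ × ℚ)} {a b : ℚ × ℚ} (ha : a ∈ P) (hb : b ∈ P) :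
    yr P a < yr P b ↔ a.2 < b.2 := rank_lt_iff Prod.snd ha hb

abbrev srt (P : List (ℚ × ℚ)) : List (ℚ × ℚ) := P.mergeSort (fun a b => decide (a.1 ≤ b.1))

theorem srt_strict {P : List (ℚ × ℚ)} (hP : P.Pairwise (fun a b => a.1 ≠ b.1)) :
    (srt P).Pairwise (fun a b => a.1 < b.1) := by
  have h1 : (srt P).Pairwise (fun a b => a.1 ≤ b.1) := by
    have := List.pairwise_mergeSort (le := fun a b : ℚ × ℚ => decide (a.1 ≤ b.1))
      (fun a b c => by simpa using fun h h' => le_trans h h')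
      (fun a b => by simpa using le_total a.1 b.1) P
    simpa using this
  have h2 : (srt P).Pairwise (fun a b => a.1 ≠ b.1) :=
    hP.perm (List.mergeSort_perm _ _).symm (fun h => h.symm)
  exact (h1.and h2).imp (fun h => lt_of_le_of_ne h.1 h.2)

theorem xr_get {P : List (ℚ × ℚ)} (hP : P.Pairwise (fun a b => a.1 ≠ b.1)) {i : ℕ} {a : ℚ × ℚ}
    (h : (srt P)[i]? = some a) : xr P a = i := by
  have hs := srt_strict hP
  have hperm : (srt P).Perm P := List.mergeSort_perm _ _
  unfold xr
  rw [← hperm.countP_eq]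
  generalize srt P = S at *
  clear hperm hP
  induction S generalizing i with
  | nil => simp at h
  | cons c t ih =>
    rw [List.pairwise_cons] at hs
    cases i with
    | zero =>
      simp at h; subst h
      rw [List.countP_eq_zero]
      intro x hx
      rcases List.mem_cons.1 hx with rfl | hx
      · simp
      · simpa using (hs.1 x hx).le
    | succ i =>
      simp at h
      rw [List.countP_cons, ih h hs.2]
      simp [hs.1 a (List.mem_of_getElem? h)]

theorem get_xr {P : List (ℚ × ℚ)} (hP : P.Pairwise (fun a b => a.1 ≠ b.1)) {a : ℚ × ℚ}
    (h : a ∈ P) : (srt P)[xr P a]? = some a := by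
  have : a ∈ srt P := (List.mergeSort_perm _ _).mem_iff.2 h
  obtain ⟨i, hi⟩ := List.mem_iff_getElem?.1 this
  rw [xr_get hP hi, hi]

theorem vals_eq (P : List (ℚ × ℚ)) : (toCPerm P).vals = (srt P).map (yr P) := by
  simp only [toCPerm]
  apply List.map_congr_left
  intro a _
  rw [← List.countP_eq_length_filter, List.countP_map]
  rfl

theorem origin_eq (P : List (ℚ × ℚ)) : (toCPerm P).origin = xr P (0, 0) := by
  simp only [toCPerm]
  rw [← List.countP_eq_length_filter, List.countP_map]
  rfl

def M (P Q : List (ℚ × ℚ)) (a b : ℚ × ℚ) : Prop :=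
  a ∈ P ∧ b ∈ Q ∧ xr P a = xr Q b ∧ yr P a = yr Q b

theorem exists_match {P Q : List (ℚ × ℚ)} (hP : P.Pairwise (fun a b => a.1 ≠ b.1))
    (hQ : Q.Pairwise (fun a b => a.1 ≠ b.1)) (h : toCPerm P = toCPerm Q) {a : ℚ × ℚ}
    (ha : a ∈ P) : ∃ b, M P Q a b := by
  have h1 := get_xr hP ha
  have hv : (srt P).map (yr P) = (srt Q).map (yr Q) := by rw [← vals_eq, ← vals_eq, h]
  have h2 : ((srt Q).map (yr Q))[xr P a]? = some (yr P a) := by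
    rw [← hv, List.getElem?_map, h1]; rfl
  rw [List.getElem?_map, Option.map_eq_some_iff] at h2
  obtain ⟨b, hb, hy⟩ := h2
  refine ⟨b, ha, ?_, (xr_get hQ hb).symm, hy.symm⟩
  exact (List.mergeSort_perm _ _).mem_iff.1 (List.mem_of_getElem? hb)

theorem match_zero {P Q : List (ℚ × ℚ)} (hP : P.Pairwise (fun a b => a.1 ≠ b.1))
    (hQ : Q.Pairwise (fun a b => a.1 ≠ b.1)) (h : toCPerm P = toCPerm Q)
    (h0 : (0, 0) ∈ P) (h0' : (0, 0) ∈ Q) : M P Q (0, 0) (0, 0) := by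
  obtain ⟨b, hb⟩ := exists_match hP hQ h h0
  have : xr P (0, 0) = xr Q (0, 0) := by rw [← origin_eq, ← origin_eq, h]
  have e1 := get_xr hQ hb.2.1
  rw [← hb.2.2.1, this, get_xr hQ h0'] at e1
  simp only [Option.some.injEq] at e1
  subst e1
  exact hb

theorem M.x {P Q a b a' b'} (h : M P Q a b) (h' : M P Q a' b') : a.1 < a'.1 ↔ b.1 < b'.1 := by
  rw [← xr_lt_iff h.1 h'.1, ← xr_lt_iff h.2.1 h'.2.1, h.2.2.1, h'.2.2.1]

theorem M.y {P Q a b a' b'} (h : M P Q a b) (h' : M P Q a' b') : a.2 < a'.2 ↔ b.2 < b'.2 := by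
  rw [← yr_lt_iff h.1 h'.1, ← yr_lt_iff h.2.1 h'.2.1, h.2.2.2, h'.2.2.2]

theorem M.symm {P Q a b} (h : M P Q a b) : M Q P b a :=
  ⟨h.2.1, h.1, h.2.2.1.symm, h.2.2.2.symm⟩

theorem aux_pos {m y n : ℚ} (hm : 0 ≤ m) (h : m < y) :
    0 < if m < y then (y + m) / 2 else (y + n) / 2 := by
  rw [if_pos h]; linarith

/-- In a word without `d`, only the first two points can be below the origin. -/
theorem neg_pts {q : ℕ} (s : PinLetter) (t : List PinLetter)
    (hp : PinAlt (s :: t)) (hd : PinLetter.d ∉ s :: t) :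
    ∀ p ∈ pinPts q (s :: t), p.2 < 0 → p = firstPt q ∨ p = np [firstPt q, (0, 0)] s := by
  induction t using List.reverseRecOn with
  | nil =>
    intro p hp hneg
    have : pinPts q [s] = [np [firstPt q, (0, 0)] s, firstPt q, (0, 0)] := rfl
    rw [this] at hp
    simp only [List.mem_cons, List.not_mem_nil, or_false] at hp
    rcases hp with h | h | h
    · exact Or.inr h
    · exact Or.inl h
    · subst h; simp at hneg
  | append_singleton m z ih =>
    intro p hpm hneg
    rw [← List.cons_append] at hp hd hpm
    rw [pinPts_snoc] at hpm
    have hal := alt_last hp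
    rcases List.mem_cons.1 hpm with rfl | hpm
    · exfalso
      have h0 := zero_mem q (s :: m)
      have key : z.isVert = false → 0 < (np (pinPts q (s :: m)) z).2 := by
        intro hz
        obtain ⟨m', w, hw⟩ : ∃ m' w, s :: m = m' ++ [w] :=
          ⟨_, _, (List.dropLast_append_getLast (List.cons_ne_nil s m)).symm⟩
        have hwv : w.isVert = true := by
          have := hal.2 w (by rw [hw]; simp)
          simpa [hz] using this
        have hwd : w ≠ .d := by
          rintro rfl
          exact hd (by rw [hw]; simp)
        have hwu : w = .u := by cases w <;> simp_all [PinLetter.isVert]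
        subst hwu
        rw [hw, pinPts_snoc]
        have hm := maxOf_nonneg ((pinPts q m').map Prod.snd)
        have e : (np (pinPts q m') .u).2 = maxOf ((pinPts q m').map Prod.snd) + 1 := rfl
        have hlt : maxOf ((pinPts q m').map Prod.snd) < (np (pinPts q m') .u).2 := by
          rw [e]; linarith
        cases z <;> simp [PinLetter.isVert] at hz
        all_goals
          exact aux_pos hm hlt
      cases z with
      | u => have := np_u h0; simp at this; linarith
      | d => exact hd (by simp)
      | l => have := key rfl; linarith
      | r => have := key rfl; linarith
    · exact ih hal.1 (fun h => hd (List.mem_append_left _ h)) p hpm hneg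

/-- Two on each side contradict separation. -/
theorem sep_two (g : ℚ × ℚ → ℚ) {x : ℚ} {e : ℚ × ℚ} {rest : List (ℚ × ℚ)}
    (h : Sep x (g e) (rest.map g)) {a b c d : ℚ × ℚ}
    (ha : a ∈ e :: rest) (hb : b ∈ e :: rest) (hc : c ∈ e :: rest) (hd : d ∈ e :: rest)
    (hab : a ≠ b) (hcd : c ≠ d) (hax : g a < x) (hbx : g b < x) (hcx : x < g c) (hdx : x < g d) :
    False := by
  have aux : ∀ {p}, p ∈ e :: rest → p = e ∨ g p ∈ rest.map g := fun hp =>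
    (List.mem_cons.1 hp).imp id (fun h => List.mem_map_of_mem h)
  rcases h with ⟨h1, h2⟩ | ⟨h1, h2⟩
  · have hc' : c = e := (aux hc).resolve_right (fun h => by have := h2 _ h; linarith)
    have hd' : d = e := (aux hd).resolve_right (fun h => by have := h2 _ h; linarith)
    exact hcd (hc'.trans hd'.symm)
  · have ha' : a = e := (aux ha).resolve_right (fun h => by have := h2 _ h; linarith)
    have hb' : b = e := (aux hb).resolve_right (fun h => by have := h2 _ h; linarith)
    exact hab (ha'.trans hb'.symm)

end PinAux

/-- In any collision `{w₁, w₂}` of pin words of length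
`≥ 6` with `w₁` ending in the letters `d`,`r`, the lowest point of the common
permutation cannot be the first point placed by `w₂`. -/
theorem collision_lowest_not_initial (q₁ q₂ : ℕ) (ls₁ ls₂ : List PinLetter)
    (h₁ : IsPinWord q₁ ls₁) (h₂ : IsPinWord q₂ ls₂)
    (hlen : ls₁.length = ls₂.length) (hn : 5 ≤ ls₁.length)
    (hend : ∃ pre : List PinLetter, ls₁ = pre ++ [PinLetter.d, PinLetter.r])
    (hne : (q₁, ls₁) ≠ (q₂, ls₂))
    (hcol : pinPerm q₁ ls₁ = pinPerm q₂ ls₂) :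
    ¬ IsLowestPoint q₂ ls₂ (firstPlacedPoint q₂ ls₂) := by
  intro hlow
  rw [PinAux.firstPlaced] at hlow
  obtain ⟨pre, hpre⟩ := hend
  obtain ⟨ha1, ha4, halt1⟩ := h₁
  obtain ⟨hb1, hb4, halt2⟩ := h₂
  have hlen2 : 5 ≤ ls₂.length := hlen ▸ hn
  -- the last three letters of the first word
  obtain ⟨pre', s, rfl⟩ : ∃ pre' s, pre = pre' ++ [s] := by
    have : pre ≠ [] := by
      rintro rfl
      rw [hpre] at hn; simp at hn
    exact ⟨_, _, (List.dropLast_append_getLast this).symm⟩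
  have e3 : ls₁ = (pre' ++ [s] ++ [PinLetter.d]) ++ [PinLetter.r] := by simp [hpre]
  rw [e3] at halt1 hcol
  have haltd := (PinAux.alt_last halt1).1
  have halts := (PinAux.alt_last haltd).1
  have hsv : s.isVert = false := by
    have := (PinAux.alt_last haltd).2 s (by simp)
    simpa [PinLetter.isVert] using this
  obtain ⟨e, rest, hW⟩ := PinAux.pinPts_ne_nil q₁ pre'
  have hV : pinPts q₁ (pre' ++ [s]) = PinAux.np (e :: rest) s :: e :: rest := by
    rw [PinAux.pinPts_snoc, hW]
  have sepc := PinAux.sepY ha1 ha4 halts hsv hW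
  generalize hc : PinAux.np (e :: rest) s = c at hV sepc
  have hU : pinPts q₁ (pre' ++ [s] ++ [PinLetter.d]) =
      PinAux.np (c :: e :: rest) .d :: c :: e :: rest := by
    rw [PinAux.pinPts_snoc, hV]
  have sepA := PinAux.sepX ha1 ha4 haltd rfl hV
  have lowA : ∀ p ∈ c :: e :: rest, (PinAux.np (c :: e :: rest) .d).2 < p.2 :=
    fun p hp => PinAux.np_d hp
  generalize PinAux.np (c :: e :: rest) .d = A at hU sepA lowA
  have hT : pinPts q₁ (pre' ++ [s] ++ [PinLetter.d] ++ [PinLetter.r]) =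
      PinAux.np (A :: c :: e :: rest) .r :: A :: c :: e :: rest := by
    rw [PinAux.pinPts_snoc, hU]
  have sepB := PinAux.sepY ha1 ha4 halt1 rfl hU
  have rightB : ∀ p ∈ A :: c :: e :: rest, p.1 < (PinAux.np (A :: c :: e :: rest) .r).1 :=
    fun p hp => PinAux.np_r hp
  generalize PinAux.np (A :: c :: e :: rest) .r = B at hT sepB rightB
  have h0 : ((0, 0) : ℚ × ℚ) ∈ c :: e :: rest := hV ▸ PinAux.zero_mem q₁ (pre' ++ [s])
  have hAB : A.2 < B.2 ∧ ∀ p ∈ c :: e :: rest, B.2 < p.2 := by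
    rcases sepB with ⟨h1, h2⟩ | ⟨h1, h2⟩
    · have := h2 c.2 (by simp)
      have := lowA c (by simp)
      linarith
    · exact ⟨h1, fun p hp => h2 _ (List.mem_map_of_mem hp)⟩
  have hB0 := hAB.2 _ h0
  simp only at hB0
  -- matching
  have dP := PinAux.distinctX ha1 ha4 halt1
  have dQ := PinAux.distinctX hb1 hb4 halt2
  have m0 := PinAux.match_zero dP dQ hcol (PinAux.zero_mem _ _) (PinAux.zero_mem _ _)
  have toP : ∀ b ∈ pinPts q₂ ls₂, ∃ a, PinAux.M _ (pinPts q₂ ls₂) a b := fun b hb => by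
    obtain ⟨a, ha⟩ := PinAux.exists_match dQ dP hcol.symm hb
    exact ⟨a, ha.symm⟩
  have toQ : ∀ a ∈ B :: A :: c :: e :: rest, ∃ b, PinAux.M _ (pinPts q₂ ls₂) a b :=
    fun a ha => PinAux.exists_match dP dQ hcol (hT.symm ▸ ha)
  rw [hT] at toP m0
  obtain ⟨A', mA⟩ := toQ A (by simp)
  obtain ⟨B', mB⟩ := toQ B (by simp)
  rw [hT] at mA mB
  clear toQ
  -- the second word has no `d` and starts in quadrant 3 or 4
  have hq : (firstPt q₂).2 < 0 := by
    rcases hlow.2 _ (PinAux.zero_mem q₂ ls₂) with h | h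
    · exfalso
      revert h
      interval_cases q₂ <;> simp [firstPt]
    · exact h
  have hnod : PinLetter.d ∉ ls₂ := by
    intro hd
    obtain ⟨l1, l2, rfl⟩ := List.append_of_mem hd
    have hm : PinAux.np (pinPts q₂ l1) .d ∈ pinPts q₂ (l1 ++ PinLetter.d :: l2) := by
      have := PinAux.pinPts_sub q₂ (l1 ++ [PinLetter.d]) l2
        (p := PinAux.np (pinPts q₂ l1) .d) (by rw [PinAux.pinPts_snoc]; simp)
      simpa using this
    have hlt := PinAux.np_d (PinAux.first_mem q₂ l1)
    rcases hlow.2 _ hm with h | h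
    · rw [h] at hlt; exact lt_irrefl _ hlt
    · linarith
  obtain ⟨s2, t, rfl⟩ : ∃ s2 t, ls₂ = s2 :: t := by
    cases ls₂ with
    | nil => simp at hlen2
    | cons a t => exact ⟨a, t, rfl⟩
  have hneg := PinAux.neg_pts (q := q₂) s2 t halt2 hnod
  have yAB := (PinAux.M.y mA mB).1 hAB.1
  have yB0 : B'.2 < 0 := (PinAux.M.y mB m0).1 hB0
  have xB0 : 0 < B'.1 := (PinAux.M.x m0 mB).1 (rightB _ (List.mem_cons_of_mem _ h0))
  have lowA' := hlow.2 A' mA.2.1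
  have hB' : B' = PinAux.np [firstPt q₂, (0, 0)] s2 := by
    refine (hneg B' mB.2.1 yB0).resolve_left ?_
    rintro rfl
    rcases lowA' with h | h
    · rw [h] at yAB; exact lt_irrefl _ yAB
    · linarith
  have hA' : A' = firstPt q₂ := by
    refine (hneg A' mA.2.1 (yAB.trans yB0)).resolve_right ?_
    intro h
    rw [h, ← hB'] at yAB
    exact lt_irrefl _ yAB
  have hq34 : q₂ = 3 ∨ q₂ = 4 := by
    revert hq
    interval_cases q₂ <;> simp [firstPt]
  have hs2 : s2 = .r := by
    cases s2 with
    | u =>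
      exfalso
      have := PinAux.np_u (pts := [firstPt q₂, (0, 0)]) (p := (0, 0)) (by simp)
      rw [← hB'] at this
      simp only at this
      linarith
    | d => exact absurd (by simp) hnod
    | l =>
      exfalso
      have := PinAux.np_l (pts := [firstPt q₂, (0, 0)]) (p := (0, 0)) (by simp)
      rw [← hB'] at this
      simp only at this
      linarith
    | r => rfl
  subst hs2
  have hBmem : B' ∈ pinPts q₂ [PinLetter.r] := by
    have : pinPts q₂ [PinLetter.r] =
      [PinAux.np [firstPt q₂, (0, 0)] .r, firstPt q₂, (0, 0)] := rfl
    rw [this, hB']; simp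
  have hnor : PinLetter.r ∉ t := by
    intro hr
    obtain ⟨l1, l2, rfl⟩ := List.append_of_mem hr
    have hm : PinAux.np (pinPts q₂ (PinLetter.r :: l1)) .r ∈
        pinPts q₂ (PinLetter.r :: (l1 ++ PinLetter.r :: l2)) := by
      have := PinAux.pinPts_sub q₂ (PinLetter.r :: l1 ++ [PinLetter.r]) l2
        (p := PinAux.np (pinPts q₂ (PinLetter.r :: l1)) .r) (by rw [PinAux.pinPts_snoc]; simp)
      simpa using this
    have hlt := PinAux.np_r (PinAux.pinPts_sub q₂ [PinLetter.r] l1 hBmem)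
    obtain ⟨a, ha⟩ := toP _ hm
    have h1 := (PinAux.M.x mB ha).2 hlt
    rcases List.mem_cons.1 ha.1 with h | h
    · rw [h] at h1; exact lt_irrefl _ h1
    · have := rightB _ h; linarith
  obtain ⟨t', rfl⟩ : ∃ t', t = .u :: .l :: .u :: .l :: t' := by
    have hch : List.IsChain (fun a b : PinLetter => a.isVert ≠ b.isVert) (PinLetter.r :: t) := halt2
    match t, hlen2, hnor, hnod, hch with
    | a :: b :: c :: d :: t', _, hnor, hnod, hch =>
      refine ⟨t', ?_⟩
      simp only [List.isChain_cons_cons] at hch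
      obtain ⟨h1, h2, h3, h4, -⟩ := hch
      cases a <;> simp [PinLetter.isVert] at h1 hnor hnod h2
      cases b <;> simp [PinLetter.isVert] at h2 hnor hnod h3
      cases c <;> simp [PinLetter.isVert] at h3 hnor hnod h4
      cases d <;> simp [PinLetter.isVert] at h4 hnor hnod
      rfl
  have sub : ∀ p ∈ pinPts q₂ [.r, .u, .l, .u, .l],
      p ∈ pinPts q₂ (.r :: .u :: .l :: .u :: .l :: t') := fun p hp =>
    PinAux.pinPts_sub q₂ [.r, .u, .l, .u, .l] t' hp
  have box : ∀ {a b}, PinAux.M (B :: A :: c :: e :: rest)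
      (pinPts q₂ (.r :: .u :: .l :: .u :: .l :: t')) a b → 0 < b.2 →
      a ∈ c :: e :: rest := by
    intro a b h hb
    have h1 := (PinAux.M.y m0 h).2 hb
    simp only at h1
    rcases List.mem_cons.1 h.1 with h | h
    · rw [h] at h1; linarith
    · rcases List.mem_cons.1 h with h | h
      · rw [h] at h1; linarith [hAB.1]
      · exact h
  have neX : ∀ {a a' b b'}, PinAux.M (B :: A :: c :: e :: rest)
      (pinPts q₂ (.r :: .u :: .l :: .u :: .l :: t')) a b →
      PinAux.M (B :: A :: c :: e :: rest)
        (pinPts q₂ (.r :: .u :: .l :: .u :: .l :: t')) a' b' → b.1 < b'.1 → a ≠ a' := by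
    intro a a' b b' h h' hlt
    have := (PinAux.M.x h h').2 hlt
    rintro rfl
    exact lt_irrefl _ this
  subst hA'
  rcases hq34 with rfl | rfl
  · have hpts : pinPts 3 [.r, .u, .l, .u, .l] =
        [(-3, 3/2), (-3/2, 2), (-2, 1/2), (1/2, 1), (1, -1/2), (-1, -1), (0, 0)] := by
      norm_num [pinPts, pinStep, maxOf, minOf, firstPt]
    rw [hpts] at sub
    obtain ⟨a3, m3⟩ := toP (1/2, 1) (sub _ (by simp))
    obtain ⟨a4, m4⟩ := toP (-2, 1/2) (sub _ (by simp))
    obtain ⟨a5, m5⟩ := toP (-3/2, 2) (sub _ (by simp))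
    refine PinAux.sep_two Prod.fst sepA (box m4 (by norm_num)) (box m5 (by norm_num)) h0
      (box m3 (by norm_num)) (neX m4 m5 (by norm_num)) (neX m0 m3 (by norm_num))
      ((PinAux.M.x m4 mA).2 ?_) ((PinAux.M.x m5 mA).2 ?_) ((PinAux.M.x mA m0).2 ?_)
      ((PinAux.M.x mA m3).2 ?_) <;> norm_num [firstPt]
  · have hpts : pinPts 4 [.r, .u, .l, .u, .l] =
        [(-2, 3/2), (-1/2, 2), (-1, 1/2), (3/2, 1), (2, -1/2), (1, -1), (0, 0)] := by
      norm_num [pinPts, pinStep, maxOf, minOf, firstPt]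
    rw [hpts] at sub
    obtain ⟨a3, m3⟩ := toP (3/2, 1) (sub _ (by simp))
    obtain ⟨a4, m4⟩ := toP (-1, 1/2) (sub _ (by simp))
    obtain ⟨a5, m5⟩ := toP (-1/2, 2) (sub _ (by simp))
    obtain ⟨a6, m6⟩ := toP (-2, 3/2) (sub _ (by simp))
    have b3 := box m3 (by norm_num)
    have b4 := box m4 (by norm_num)
    have x3 : A.1 < a3.1 := (PinAux.M.x mA m3).2 (by norm_num [firstPt])
    have x4 : a4.1 < A.1 := (PinAux.M.x m4 mA).2 (by norm_num [firstPt])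
    have x0 : (0 : ℚ) < A.1 := (PinAux.M.x m0 mA).2 (by norm_num [firstPt])
    -- a3 is the point placed just before A
    have hc3 : a3 = c := by
      rcases sepA with ⟨h1, h2⟩ | ⟨h1, h2⟩
      · rcases List.mem_cons.1 b3 with h | h
        · exact h
        · have := h2 _ (List.mem_map_of_mem (f := Prod.fst) h); linarith
      · exfalso
        have g4 : a4 = c := (List.mem_cons.1 b4).resolve_right (fun h => by
          have := h2 _ (List.mem_map_of_mem (f := Prod.fst) h); linarith)
        have g0 : (0, 0) = c := (List.mem_cons.1 h0).resolve_right (fun h => by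
          have := h2 _ (List.mem_map_of_mem (f := Prod.fst) h); simp only at this; linarith)
        exact neX m4 m0 (by norm_num) (g4.trans g0.symm)
    subst hc3
    have inr : ∀ {a}, a ∈ a3 :: e :: rest → a ≠ a3 → a ∈ e :: rest := fun h hne =>
      (List.mem_cons.1 h).resolve_left hne
    refine PinAux.sep_two Prod.snd sepc
      (inr b4 (neX m4 m3 (by norm_num))) (inr h0 (neX m0 m3 (by norm_num)))
      (inr (box m6 (by norm_num)) (neX m6 m3 (by norm_num)))
      (inr (box m5 (by norm_num)) (neX m5 m3 (by norm_num)))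
      (neX m4 m0 (by norm_num)) (neX m6 m5 (by norm_num))
      ((PinAux.M.y m4 m3).2 ?_) ((PinAux.M.y m0 m3).2 ?_) ((PinAux.M.y m3 m6).2 ?_)
      ((PinAux.M.y m3 m5).2 ?_) <;> norm_num
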